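/- Let n ≥ 3, R > 0, and let f be a smooth harmonic function on {x ∈ ℝⁿ : |x| > R} such that f(x) = o(|x|^{1−n}) as |x| → ∞. Then f(x) = O(|x|^{−n}) as |x| → ∞. -/

import Mathlib

open Filter

/-- The Laplacian `Δf = ∑ i, ∂²f/∂xᵢ²` of a map `f : ℝⁿ → E`, computed via iterated
Fréchet derivatives in the coordinate directions. -/
noncomputable def vecLaplacian {n : ℕ} {E : Type*} [NormedAddCommGroup E] [NormedSpace ℝ E]
    (f : EuclideanSpace ℝ (Fin n) → E) (x : EuclideanSpace ℝ (Fin n)) : E :=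
  ∑ i : Fin n,
    fderiv ℝ (fun y => fderiv ℝ f y (EuclideanSpace.single i 1)) x (EuclideanSpace.single i 1)

/-- `f` is harmonic on the open set `U`: it is smooth on `U` and `Δf = 0` on `U`. -/
def IsHarmonicOn {n : ℕ} {E : Type*} [NormedAddCommGroup E] [NormedSpace ℝ E]
    (f : EuclideanSpace ℝ (Fin n) → E) (U : Set (EuclideanSpace ℝ (Fin n))) : Prop :=
  ContDiffOn ℝ (⊤ : ℕ∞) f U ∧ ∀ x ∈ U, vecLaplacian f x = 0

open MeasureTheory Asymptotics
open scoped Topology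

section RealCalculus

theorem hasDerivAt_ite_le {f g f' g' : ℝ → ℝ} {c : ℝ}
    (hf : ∀ t ≤ c, HasDerivAt f (f' t) t) (hg : ∀ t, c ≤ t → HasDerivAt g (g' t) t)
    (h0 : f c = g c) (h1 : f' c = g' c) (t : ℝ) :
    HasDerivAt (fun s => if s ≤ c then f s else g s) (if t ≤ c then f' t else g' t) t := by
  rcases lt_trichotomy t c with h | h | h
  · rw [if_pos h.le]
    refine (hf t h.le).congr_of_eventuallyEq ?_
    filter_upwards [Iio_mem_nhds h] with s hs
    rw [if_pos (le_of_lt hs)]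
  · subst h
    rw [if_pos le_rfl, ← hasDerivWithinAt_univ, ← Set.Iic_union_Ici (a := t)]
    refine HasDerivWithinAt.union ?_ ?_
    · refine (hf t le_rfl).hasDerivWithinAt.congr (fun s hs => if_pos hs) (if_pos le_rfl)
    · rw [h1]
      refine (hg t le_rfl).hasDerivWithinAt.congr (fun s hs => ?_) (by rw [if_pos le_rfl, h0])
      split_ifs with hst
      · rw [le_antisymm hst hs, h0]
      · rfl
  · rw [if_neg h.not_ge]
    refine (hg t h.le).congr_of_eventuallyEq ?_
    filter_upwards [Ioi_mem_nhds h] with s hs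
    rw [if_neg (not_le.2 hs)]

/-- The function `t ↦ t ^ (-a)`, replaced on `t ≤ 1` by its second order Taylor polynomial
at `1`. -/
noncomputable def tamedPow (a t : ℝ) : ℝ :=
  if t ≤ 1 then 1 - a * (t - 1) + a * (a + 1) / 2 * (t - 1) ^ 2 else t ^ (-a)

/-- The first derivative of `tamedPow`. -/
noncomputable def tamedPowDeriv (a t : ℝ) : ℝ :=
  if t ≤ 1 then -a + a * (a + 1) * (t - 1) else -a * t ^ (-a - 1)

/-- The second derivative of `tamedPow`. -/
noncomputable def tamedPowDerivTwo (a t : ℝ) : ℝ :=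
  if t ≤ 1 then a * (a + 1) else a * (a + 1) * t ^ (-a - 2)

theorem hasDerivAt_tamedPow (a t : ℝ) : HasDerivAt (tamedPow a) (tamedPowDeriv a t) t := by
  refine hasDerivAt_ite_le (f := fun t => 1 - a * (t - 1) + a * (a + 1) / 2 * (t - 1) ^ 2)
    (g := fun t => t ^ (-a)) (f' := fun t => -a + a * (a + 1) * (t - 1))
    (g' := fun t => -a * t ^ (-a - 1)) (fun t _ => ?_) (fun t ht => ?_) ?_ ?_ t
  · have h := (hasDerivAt_id t).sub_const 1
    refine (((h.const_mul a).const_sub 1).add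
      ((h.pow 2).const_mul (a * (a + 1) / 2))).congr_deriv ?_
    simp only [id]
    push_cast
    ring
  · exact Real.hasDerivAt_rpow_const (Or.inl (by positivity))
  · simp
  · simp

theorem hasDerivAt_tamedPowDeriv (a t : ℝ) :
    HasDerivAt (tamedPowDeriv a) (tamedPowDerivTwo a t) t := by
  refine hasDerivAt_ite_le (f := fun t => -a + a * (a + 1) * (t - 1))
    (g := fun t => -a * t ^ (-a - 1)) (f' := fun _ => a * (a + 1))
    (g' := fun t => a * (a + 1) * t ^ (-a - 2)) (fun t _ => ?_) (fun t ht => ?_) ?_ ?_ t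
  · have h := (hasDerivAt_id t).sub_const 1
    exact ((h.const_mul (a * (a + 1))).const_add (-a)).congr_deriv (by ring)
  · refine ((Real.hasDerivAt_rpow_const (x := t) (p := -a - 1)
      (Or.inl (by positivity))).const_mul (-a)).congr_deriv ?_
    rw [show -a - 1 - 1 = -a - 2 by ring]
    ring
  · simp
  · simp

theorem continuous_tamedPowDerivTwo (a : ℝ) : Continuous (tamedPowDerivTwo a) := by
  have h : tamedPowDerivTwo a = fun t => a * (a + 1) * (max 1 t) ^ (-a - 2) := by
    ext t
    unfold tamedPowDerivTwo
    split_ifs with ht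
    · simp [max_eq_left ht]
    · rw [max_eq_right (not_le.1 ht).le]
  rw [h]
  refine continuous_const.mul (Continuous.rpow_const (by fun_prop) fun t => Or.inl ?_)
  exact (lt_of_lt_of_le one_pos (le_max_left 1 t)).ne'

theorem tamedPow_of_one_le {a t : ℝ} (ht : 1 ≤ t) : tamedPow a t = t ^ (-a) := by
  rcases ht.eq_or_lt with rfl | h
  · simp [tamedPow]
  · rw [tamedPow, if_neg h.not_ge]

theorem abs_tamedPow_le {a t : ℝ} (ha : 0 ≤ a) (ht : 0 ≤ t) :
    |tamedPow a t| ≤ 1 + a + a * (a + 1) / 2 := by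
  rw [abs_le]
  have h2 : 0 ≤ a * (a + 1) / 2 := by positivity
  by_cases h : t ≤ 1
  · rw [tamedPow, if_pos h]
    have h1 : (t - 1) ^ 2 ≤ 1 := by nlinarith
    constructor <;> nlinarith [sq_nonneg (t - 1), mul_nonneg ha ht]
  · rw [tamedPow, if_neg h]
    have h3 := Real.rpow_le_one_of_one_le_of_nonpos (not_le.1 h).le (neg_nonpos.2 ha)
    have h4 := Real.rpow_nonneg ht (-a)
    constructor <;> linarith

theorem tamedPow_laplacian (a t : ℝ) :
    4 * t * tamedPowDerivTwo a t + 4 * (a + 1) * tamedPowDeriv a t =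
      -(4 * a * (a + 1) * (a + 2) * max (1 - t) 0) := by
  unfold tamedPowDerivTwo tamedPowDeriv
  split_ifs with h
  · rw [max_eq_left (by linarith)]
    ring
  · push Not at h
    rw [max_eq_right (by linarith)]
    have : t ^ (-a - 1) = t * t ^ (-a - 2) := by
      rw [show -a - 1 = 1 + (-a - 2) by ring, Real.rpow_add (by linarith), Real.rpow_one]
    rw [this]
    ring

theorem AnalyticAt.sub_sub_isBigO_sq {g : ℝ → ℝ} {g' : ℝ} {x : ℝ} (hg : AnalyticAt ℝ g x)
    (hg' : HasDerivAt g g' x) :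
    (fun y => g (x + y) - g x - y * g') =O[𝓝 0] fun y => y ^ 2 := by
  obtain ⟨p, hp⟩ := hg
  have h := hp.isBigO_sub_partialSum_pow 2
  have h0 : p.coeff 0 = g x := hp.coeff_zero _
  have h1 : p.coeff 1 = g' := hp.hasDerivAt.unique hg'
  refine (h.congr_left fun y => ?_).trans (isBigO_of_le _ fun y => by simp)
  simp [FormalMultilinearSeries.partialSum, Finset.sum_range_succ, h0, h1, sub_sub]

theorem exists_abs_rpow_neg_sub_le (a : ℝ) : ∃ C > 0, ∃ r > 0, ∀ y : ℝ, |y| ≤ r →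
    |(1 + y) ^ (-a) - 1 + a * y| ≤ C * y ^ 2 := by
  have h := AnalyticAt.sub_sub_isBigO_sq (g := fun t : ℝ => t ^ (-a)) (x := 1)
    (Real.contDiffAt_rpow_const_of_ne one_ne_zero).analyticAt
    (Real.hasDerivAt_rpow_const (Or.inl one_ne_zero))
  obtain ⟨C, hC, h⟩ := h.exists_pos
  obtain ⟨r, hr, h⟩ := Metric.eventually_nhds_iff_ball.1 h.bound
  refine ⟨C, hC, r / 2, by positivity, fun y hy => ?_⟩
  have := h y (by rw [Metric.mem_ball, dist_zero_right, Real.norm_eq_abs]; linarith)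
  simp only [Real.one_rpow, norm_pow, Real.norm_eq_abs, sq_abs, mul_one] at this
  convert this using 2
  ring

end RealCalculus

section Laplacian

variable {n : ℕ}

theorem vecLaplacian_congr {E : Type*} [NormedAddCommGroup E] [NormedSpace ℝ E]
    {f g : EuclideanSpace ℝ (Fin n) → E} {x : EuclideanSpace ℝ (Fin n)} (h : f =ᶠ[𝓝 x] g) :
    vecLaplacian f x = vecLaplacian g x := by
  unfold vecLaplacian
  refine Finset.sum_congr rfl fun i _ => ?_
  have : (fun y => fderiv ℝ f y (EuclideanSpace.single i 1)) =ᶠ[𝓝 x]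
      fun y => fderiv ℝ g y (EuclideanSpace.single i 1) := by
    filter_upwards [h.fderiv (𝕜 := ℝ)] with y hy
    rw [hy]
  rw [this.fderiv_eq]

theorem contDiff_fderiv_single {f : EuclideanSpace ℝ (Fin n) → ℝ} (hf : ContDiff ℝ 2 f)
    (i : Fin n) : ContDiff ℝ 1 fun y => fderiv ℝ f y (EuclideanSpace.single i 1) :=
  (hf.fderiv_right (m := 1) (by norm_num)).clm_apply contDiff_const

theorem continuous_fderiv_fderiv_single {f : EuclideanSpace ℝ (Fin n) → ℝ}
    (hf : ContDiff ℝ 2 f) (i : Fin n) :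
    Continuous fun x => fderiv ℝ (fun y => fderiv ℝ f y (EuclideanSpace.single i 1)) x
      (EuclideanSpace.single i 1) :=
  ((contDiff_fderiv_single hf i).continuous_fderiv (by norm_num)).clm_apply continuous_const

theorem ContDiff.continuous_vecLaplacian {f : EuclideanSpace ℝ (Fin n) → ℝ}
    (hf : ContDiff ℝ 2 f) : Continuous (vecLaplacian f) :=
  continuous_finsetSum _ fun i _ => continuous_fderiv_fderiv_single hf i

/-- Green's second identity on the whole space, for a compactly supported first factor. -/
theorem integral_mul_vecLaplacian {u v : EuclideanSpace ℝ (Fin n) → ℝ}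
    (hu : ContDiff ℝ 2 u) (hv : ContDiff ℝ 2 v) (hc : HasCompactSupport u) :
    ∫ x, u x * vecLaplacian v x = ∫ x, vecLaplacian u x * v x := by
  have hu1 := fun i => contDiff_fderiv_single hu i
  have hv1 := fun i => contDiff_fderiv_single hv i
  have hu2 := fun i => continuous_fderiv_fderiv_single hu i
  have hv2 := fun i => continuous_fderiv_fderiv_single hv i
  have hc1 : ∀ i : Fin n, HasCompactSupport
      fun y => fderiv ℝ u y (EuclideanSpace.single i 1) := fun i => hc.fderiv_apply ℝ _
  have hc2 : ∀ i : Fin n, HasCompactSupport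
      fun x => fderiv ℝ (fun y => fderiv ℝ u y (EuclideanSpace.single i 1)) x
        (EuclideanSpace.single i 1) := fun i => (hc1 i).fderiv_apply ℝ _
  have hi0 : ∀ i : Fin n, Integrable fun x => u x *
      fderiv ℝ (fun y => fderiv ℝ v y (EuclideanSpace.single i 1)) x
        (EuclideanSpace.single i 1) := fun i =>
    (hu.continuous.mul (hv2 i)).integrable_of_hasCompactSupport hc.mul_right
  have hi1 : ∀ i : Fin n, Integrable fun x => fderiv ℝ u x (EuclideanSpace.single i 1) *
      fderiv ℝ v x (EuclideanSpace.single i 1) := fun i =>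
    ((hu1 i).continuous.mul (hv1 i).continuous).integrable_of_hasCompactSupport
      (hc1 i).mul_right
  have hi2 : ∀ i : Fin n, Integrable fun x =>
      fderiv ℝ (fun y => fderiv ℝ u y (EuclideanSpace.single i 1)) x
        (EuclideanSpace.single i 1) * v x := fun i =>
    ((hu2 i).mul hv.continuous).integrable_of_hasCompactSupport (hc2 i).mul_right
  unfold vecLaplacian
  simp_rw [Finset.mul_sum, Finset.sum_mul]
  rw [integral_finsetSum _ fun i _ => hi0 i, integral_finsetSum _ fun i _ => hi2 i]
  refine Finset.sum_congr rfl fun i _ => ?_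
  rw [integral_mul_fderiv_eq_neg_fderiv_mul_of_integrable (hi1 i) (hi0 i)
    ((hu.continuous.mul (hv1 i).continuous).integrable_of_hasCompactSupport hc.mul_right)
    (fun x _ => (hu.differentiable (by norm_num)).differentiableAt)
    (fun x _ => ((hv1 i).differentiable (by norm_num)).differentiableAt),
    integral_mul_fderiv_eq_neg_fderiv_mul_of_integrable (hi2 i) (hi1 i)
    (((hu1 i).continuous.mul hv.continuous).integrable_of_hasCompactSupport (hc1 i).mul_right)
    (fun x _ => ((hu1 i).differentiable (by norm_num)).differentiableAt)
    (fun x _ => (hv.differentiable (by norm_num)).differentiableAt), neg_neg]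

theorem vecLaplacian_comp_norm_sub_sq {F F' F'' : ℝ → ℝ} (hF : ∀ t, HasDerivAt F (F' t) t)
    (hF' : ∀ t, HasDerivAt F' (F'' t) t) (x y : EuclideanSpace ℝ (Fin n)) :
    vecLaplacian (fun y => F (‖y - x‖ ^ 2)) y =
      4 * ‖y - x‖ ^ 2 * F'' (‖y - x‖ ^ 2) + 2 * n * F' (‖y - x‖ ^ 2) := by
  have hN : ∀ y : EuclideanSpace ℝ (Fin n),
      HasFDerivAt (fun y => ‖y - x‖ ^ 2) (2 • innerSL ℝ (y - x)) y := fun y => by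
    simpa using ((hasFDerivAt_id y).sub_const x).norm_sq
  have h1 : ∀ i : Fin n, ∀ y, fderiv ℝ (fun y => F (‖y - x‖ ^ 2)) y
      (EuclideanSpace.single i 1) = F' (‖y - x‖ ^ 2) * (2 * (y - x) i) := fun i y => by
    have := ((hF (‖y - x‖ ^ 2)).comp_hasFDerivAt y (hN y)).fderiv
    rw [show (fun y => F (‖y - x‖ ^ 2)) = F ∘ fun y => ‖y - x‖ ^ 2 from rfl, this]
    simp [EuclideanSpace.inner_single_right]
  have h2 : ∀ i : Fin n, fderiv ℝ (fun y => fderiv ℝ (fun y => F (‖y - x‖ ^ 2)) y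
      (EuclideanSpace.single i 1)) y (EuclideanSpace.single i 1) =
      4 * F'' (‖y - x‖ ^ 2) * (y - x) i ^ 2 + 2 * F' (‖y - x‖ ^ 2) := fun i => by
    simp_rw [h1]
    have hd : HasFDerivAt (fun y : EuclideanSpace ℝ (Fin n) => 2 * (y - x) i)
        ((2 : ℝ) • (EuclideanSpace.proj i : EuclideanSpace ℝ (Fin n) →L[ℝ] ℝ)) y := by
      have h := (EuclideanSpace.proj i : EuclideanSpace ℝ (Fin n) →L[ℝ] ℝ).hasFDerivAt.comp y
        ((hasFDerivAt_id y).sub_const x)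
      simpa [Function.comp_def] using h.const_mul 2
    have := (((hF' (‖y - x‖ ^ 2)).comp_hasFDerivAt y (hN y)).mul hd).fderiv
    simp only [Function.comp_def] at this
    rw [show (fun y => F' (‖y - x‖ ^ 2) * (2 * (y - x) i)) =
      (fun y => F' (‖y - x‖ ^ 2)) * fun y => 2 * (y - x) i from rfl, this]
    simp [EuclideanSpace.inner_single_right]
    ring
  unfold vecLaplacian
  simp_rw [h2, Finset.sum_add_distrib, ← Finset.mul_sum]
  rw [show ∑ i, (y - x) i ^ 2 = ‖y - x‖ ^ 2 by simp [EuclideanSpace.norm_sq_eq]]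
  simp
  ring

theorem contDiff_two_of_hasDerivAt {F F' F'' : ℝ → ℝ} (hF : ∀ t, HasDerivAt F (F' t) t)
    (hF' : ∀ t, HasDerivAt F' (F'' t) t) (hF'' : Continuous F'') : ContDiff ℝ 2 F := by
  have e : deriv F = F' := funext fun t => (hF t).deriv
  have e' : deriv F' = F'' := funext fun t => (hF' t).deriv
  rw [show (2 : WithTop ℕ∞) = 1 + 1 by norm_num, contDiff_succ_iff_deriv, e,
    contDiff_one_iff_deriv, e']
  exact ⟨fun t => (hF t).differentiableAt, by simp, fun t => (hF' t).differentiableAt, hF''⟩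

end Laplacian

section Representation

variable {n : ℕ}

/-- The Newtonian kernel `‖y - x‖ ^ (2 - n)`, regularised on the ball of radius `s` about `x`. -/
noncomputable def tamedKernel (s : ℝ) (x y : EuclideanSpace ℝ (Fin n)) : ℝ :=
  (s ^ 2) ^ (-((n : ℝ) / 2 - 1)) * tamedPow ((n : ℝ) / 2 - 1) (‖y - x‖ ^ 2 / s ^ 2)

theorem hasDerivAt_mul_comp_div {F F' : ℝ → ℝ} (hF : ∀ t, HasDerivAt F (F' t) t) (b l t : ℝ) :
    HasDerivAt (fun t => b * F (t / l)) (b / l * F' (t / l)) t :=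
  (((hF (t / l)).comp t ((hasDerivAt_id t).div_const l)).const_mul b).congr_deriv (by ring)

theorem contDiff_tamedKernel (s : ℝ) (x : EuclideanSpace ℝ (Fin n)) :
    ContDiff ℝ 2 (tamedKernel s x) := by
  have := contDiff_two_of_hasDerivAt (hasDerivAt_tamedPow ((n : ℝ) / 2 - 1))
    (hasDerivAt_tamedPowDeriv _) (continuous_tamedPowDerivTwo _)
  unfold tamedKernel
  exact contDiff_const.mul (this.comp (((contDiff_id.sub contDiff_const).norm_sq ℝ).div_const _))

theorem vecLaplacian_tamedKernel {s : ℝ} (hs : 0 < s) (x y : EuclideanSpace ℝ (Fin n)) :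
    vecLaplacian (tamedKernel s x) y =
      -(4 * ((n : ℝ) / 2 - 1) * (n / 2) * (n / 2 + 1)) *
        ((s ^ n)⁻¹ * max (1 - ‖y - x‖ ^ 2 / s ^ 2) 0) := by
  have h := vecLaplacian_comp_norm_sub_sq
    (hasDerivAt_mul_comp_div (hasDerivAt_tamedPow ((n : ℝ) / 2 - 1))
      ((s ^ 2) ^ (-((n : ℝ) / 2 - 1))) (s ^ 2))
    (hasDerivAt_mul_comp_div (hasDerivAt_tamedPowDeriv ((n : ℝ) / 2 - 1))
      ((s ^ 2) ^ (-((n : ℝ) / 2 - 1)) / s ^ 2) (s ^ 2)) x y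
  have e : (s ^ n)⁻¹ = (s ^ 2) ^ (-((n : ℝ) / 2 - 1)) / s ^ 2 := by
    rw [← Real.rpow_natCast s 2, ← Real.rpow_mul hs.le, ← Real.rpow_sub hs,
      ← Real.rpow_natCast s n, ← Real.rpow_neg hs.le]
    congr 1
    push_cast
    ring
  have hq := tamedPow_laplacian ((n : ℝ) / 2 - 1) (‖y - x‖ ^ 2 / s ^ 2)
  unfold tamedKernel
  rw [h, e]
  linear_combination ((s ^ 2) ^ (-((n : ℝ) / 2 - 1)) / s ^ 2) * hq

theorem tamedKernel_of_le {s : ℝ} (hs : 0 < s) {x y : EuclideanSpace ℝ (Fin n)}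
    (h : s ≤ ‖y - x‖) : tamedKernel s x y = (‖y - x‖ ^ 2) ^ (-((n : ℝ) / 2 - 1)) := by
  have h1 : 1 ≤ ‖y - x‖ ^ 2 / s ^ 2 := by
    rw [one_le_div (by positivity)]
    gcongr
  rw [tamedKernel, tamedPow_of_one_le h1, ← Real.mul_rpow (by positivity) (by positivity),
    mul_div_cancel₀ _ (by positivity)]

theorem exists_abs_tamedKernel_le (hn : 2 ≤ n) : ∃ B, ∀ (s : ℝ) (x y : EuclideanSpace ℝ (Fin n)),
    |tamedKernel s x y| ≤ B * (s ^ 2) ^ (-((n : ℝ) / 2 - 1)) := by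
  have ha : (0 : ℝ) ≤ n / 2 - 1 := by
    have : (2 : ℝ) ≤ n := by exact_mod_cast hn
    linarith
  refine ⟨1 + (n / 2 - 1) + (n / 2 - 1) * ((n / 2 - 1) + 1) / 2, fun s x y => ?_⟩
  rw [tamedKernel, abs_mul, mul_comm, abs_of_nonneg (Real.rpow_nonneg (sq_nonneg s) _)]
  exact mul_le_mul_of_nonneg_right (abs_tamedPow_le ha (by positivity))
    (Real.rpow_nonneg (sq_nonneg s) _)

theorem integral_vecLaplacian_tamedKernel_mul {s : ℝ} (hs : 0 < s)
    (x : EuclideanSpace ℝ (Fin n)) (h : EuclideanSpace ℝ (Fin n) → ℝ) :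
    ∫ y, vecLaplacian (tamedKernel s x) y * h y =
      -(4 * ((n : ℝ) / 2 - 1) * (n / 2) * (n / 2 + 1)) *
        ∫ z, max (1 - ‖z‖ ^ 2) 0 * h (x + s • z) := by
  simp_rw [vecLaplacian_tamedKernel hs,
    mul_assoc (-(4 * ((n : ℝ) / 2 - 1) * (n / 2) * (n / 2 + 1)))]
  rw [integral_const_mul]
  congr 1
  rw [← integral_add_left_eq_self _ x]
  have := Measure.integral_comp_smul (volume : Measure (EuclideanSpace ℝ (Fin n)))
    (fun y => max (1 - ‖y‖ ^ 2 / s ^ 2) 0 * h (x + y)) s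
  have e : ∀ z : EuclideanSpace ℝ (Fin n), ‖s • z‖ ^ 2 / s ^ 2 = ‖z‖ ^ 2 := fun z => by
    rw [norm_smul, mul_pow, Real.norm_eq_abs, sq_abs]
    field_simp
  simp_rw [e] at this
  rw [this, smul_eq_mul, ← integral_const_mul, finrank_euclideanSpace_fin,
    abs_of_nonneg (by positivity)]
  simp [mul_assoc]

theorem continuous_max_one_sub_norm_sq :
    Continuous fun z : EuclideanSpace ℝ (Fin n) => max (1 - ‖z‖ ^ 2) 0 := by fun_prop

theorem hasCompactSupport_max_one_sub_norm_sq :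
    HasCompactSupport fun z : EuclideanSpace ℝ (Fin n) => max (1 - ‖z‖ ^ 2) 0 := by
  refine HasCompactSupport.intro (isCompact_closedBall 0 1) fun z hz => ?_
  rw [mem_closedBall_zero_iff, not_le] at hz
  exact max_eq_right (by nlinarith)

theorem integral_max_one_sub_norm_sq_pos :
    0 < ∫ z : EuclideanSpace ℝ (Fin n), max (1 - ‖z‖ ^ 2) 0 :=
  continuous_max_one_sub_norm_sq.integral_pos_of_hasCompactSupport_nonneg_nonzero (x := 0)
    hasCompactSupport_max_one_sub_norm_sq (fun _ => le_max_right _ _) (by simp)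

theorem integral_tamedKernel_sub_mul {h : EuclideanSpace ℝ (Fin n) → ℝ} (hh : ContDiff ℝ 2 h)
    (x : EuclideanSpace ℝ (Fin n)) {s t : ℝ} (hs : 0 < s) (ht : 0 < t) :
    ∫ y, (tamedKernel s x y - tamedKernel t x y) * vecLaplacian h y =
      -(4 * ((n : ℝ) / 2 - 1) * (n / 2) * (n / 2 + 1)) *
        ((∫ z, max (1 - ‖z‖ ^ 2) 0 * h (x + s • z)) -
          ∫ z, max (1 - ‖z‖ ^ 2) 0 * h (x + t • z)) := by
  have hc : HasCompactSupport fun y => tamedKernel s x y - tamedKernel t x y := by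
    refine HasCompactSupport.intro (isCompact_closedBall x (max s t)) fun y hy => ?_
    rw [Metric.mem_closedBall, not_le, dist_eq_norm, max_lt_iff] at hy
    rw [tamedKernel_of_le hs hy.1.le, tamedKernel_of_le ht hy.2.le, sub_self]
  have hL : ∀ y, vecLaplacian (fun y => tamedKernel s x y - tamedKernel t x y) y =
      vecLaplacian (tamedKernel s x) y - vecLaplacian (tamedKernel t x) y := fun y => by
    unfold vecLaplacian
    rw [← Finset.sum_sub_distrib]
    refine Finset.sum_congr rfl fun i _ => ?_
    have e : ∀ y, fderiv ℝ (fun y => tamedKernel s x y - tamedKernel t x y) y =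
        fderiv ℝ (tamedKernel s x) y - fderiv ℝ (tamedKernel t x) y := fun y =>
      fderiv_fun_sub ((contDiff_tamedKernel s x).differentiable (by norm_num) y)
        ((contDiff_tamedKernel t x).differentiable (by norm_num) y)
    simp_rw [e, sub_apply]
    rw [fderiv_fun_sub
      ((contDiff_fderiv_single (contDiff_tamedKernel s x) i).differentiable (by norm_num) y)
      ((contDiff_fderiv_single (contDiff_tamedKernel t x) i).differentiable (by norm_num) y),
      sub_apply]
  have hi : ∀ {r : ℝ}, 0 < r →
      Integrable fun y => vecLaplacian (tamedKernel r x) y * h y := fun {r} hr => by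
    refine ((contDiff_tamedKernel r x).continuous_vecLaplacian.mul
      hh.continuous).integrable_of_hasCompactSupport ?_
    refine HasCompactSupport.mul_right ?_
    refine HasCompactSupport.intro (isCompact_closedBall x r) fun y hy => ?_
    rw [Metric.mem_closedBall, not_le, dist_eq_norm] at hy
    rw [vecLaplacian_tamedKernel hr, max_eq_right, mul_zero, mul_zero]
    rw [sub_nonpos, one_le_div (by positivity)]
    gcongr
  rw [integral_mul_vecLaplacian ((contDiff_tamedKernel s x).sub (contDiff_tamedKernel t x)) hh hc]
  simp_rw [hL, sub_mul]
  rw [integral_sub (hi hs) (hi ht), integral_vecLaplacian_tamedKernel_mul hs,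
    integral_vecLaplacian_tamedKernel_mul ht, ← mul_sub]

theorem exists_abs_le_of_tendsto_cocompact {h : EuclideanSpace ℝ (Fin n) → ℝ}
    (hh : Continuous h) (hlim : Tendsto h (cocompact _) (𝓝 0)) : ∃ B, ∀ x, |h x| ≤ B := by
  let g : ZeroAtInftyContinuousMap (EuclideanSpace ℝ (Fin n)) ℝ := ⟨⟨h, hh⟩, hlim⟩
  exact ⟨‖g.toBCF‖, fun x => g.toBCF.norm_coe_le_norm x⟩

/-- A function vanishing at infinity whose Laplacian has bounded support is, outside of a ball
containing that support, a multiple of the Newtonian potential of its Laplacian. -/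
theorem exists_mul_eq_integral_rpow_mul_vecLaplacian (hn : 3 ≤ n)
    {h : EuclideanSpace ℝ (Fin n) → ℝ} (hh : ContDiff ℝ 2 h)
    (hlim : Tendsto h (cocompact _) (𝓝 0)) {R : ℝ}
    (hR : ∀ y, R < ‖y‖ → vecLaplacian h y = 0) :
    ∃ c ≠ 0, ∀ x, R < ‖x‖ →
      c * h x = ∫ y, (‖y - x‖ ^ 2) ^ (-((n : ℝ) / 2 - 1)) * vecLaplacian h y := by
  have hn' : (3 : ℝ) ≤ n := by exact_mod_cast hn
  have ha : (0 : ℝ) < n / 2 - 1 := by linarith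
  have : Nonempty (Fin n) := ⟨⟨0, by omega⟩⟩
  obtain ⟨B, hB⟩ := exists_abs_le_of_tendsto_cocompact hh.continuous hlim
  have hw := continuous_max_one_sub_norm_sq (n := n)
  have hwi : Integrable fun z : EuclideanSpace ℝ (Fin n) => max (1 - ‖z‖ ^ 2) 0 :=
    hw.integrable_of_hasCompactSupport hasCompactSupport_max_one_sub_norm_sq
  have hsupp : HasCompactSupport (vecLaplacian h) :=
    HasCompactSupport.intro (isCompact_closedBall 0 R) fun y hy =>
      hR y (by simpa using hy)
  have hLc := hh.continuous_vecLaplacian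
  have hLi : Integrable (vecLaplacian h) := hLc.integrable_of_hasCompactSupport hsupp
  refine ⟨-(4 * ((n : ℝ) / 2 - 1) * (n / 2) * (n / 2 + 1)) *
    ∫ z : EuclideanSpace ℝ (Fin n), max (1 - ‖z‖ ^ 2) 0, ?_, fun x hx => ?_⟩
  · exact mul_ne_zero (neg_ne_zero.2 (by positivity)) integral_max_one_sub_norm_sq_pos.ne'
  have hdom : ∀ (u : ℝ → ℝ) (g : EuclideanSpace ℝ (Fin n) → ℝ),
      (∀ᵐ z, Tendsto (fun s => h (x + u s • z)) atTop (𝓝 (g z))) →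
      Tendsto (fun s => ∫ z, max (1 - ‖z‖ ^ 2) 0 * h (x + u s • z)) atTop
        (𝓝 (∫ z, max (1 - ‖z‖ ^ 2) 0 * g z)) := fun u g hg => by
    refine tendsto_integral_filter_of_dominated_convergence
      (fun z => max (1 - ‖z‖ ^ 2) 0 * B) ?_ ?_ (hwi.mul_const B) ?_
    · refine Eventually.of_forall fun s => Continuous.aestronglyMeasurable ?_
      exact hw.mul (hh.continuous.comp (by fun_prop))
    · refine Eventually.of_forall fun s => Eventually.of_forall fun z => ?_
      rw [norm_mul, Real.norm_of_nonneg (le_max_right _ _)]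
      exact mul_le_mul_of_nonneg_left (hB _) (le_max_right _ _)
    · filter_upwards [hg] with z hz using hz.const_mul _
  have hnear := hdom (fun s => s⁻¹) (fun _ => h x) (Eventually.of_forall fun z => by
    have : Tendsto (fun s : ℝ => x + s⁻¹ • z) atTop (𝓝 (x + (0 : ℝ) • z)) :=
      (tendsto_inv_atTop_zero.smul_const z).const_add x
    rw [zero_smul, add_zero] at this
    exact (hh.continuous.tendsto x).comp this)
  have hfar := hdom (fun s => s) (fun _ => 0) (by
    filter_upwards [compl_mem_ae_iff.2 (measure_singleton (0 : EuclideanSpace ℝ (Fin n)))]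
      with z hz
    refine hlim.comp ?_
    rw [← Metric.cobounded_eq_cocompact, ← tendsto_norm_atTop_iff_cobounded]
    refine tendsto_atTop_mono (f := fun s => s * ‖z‖ - ‖x‖) (fun s => ?_) ?_
    · have h1 := norm_sub_norm_le (s • z) (-x)
      rw [norm_neg, sub_neg_eq_add, norm_smul, add_comm (s • z)] at h1
      have h2 := mul_le_mul_of_nonneg_right (le_abs_self s) (norm_nonneg z)
      rw [← Real.norm_eq_abs] at h2
      linarith
    · exact tendsto_atTop_add_const_right _ _
        (tendsto_id.atTop_mul_const (norm_pos_iff.2 hz)))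
  have hright := (hnear.sub hfar).const_mul (-(4 * ((n : ℝ) / 2 - 1) * (n / 2) * (n / 2 + 1)))
  simp only [mul_zero, integral_zero, sub_zero, integral_mul_const] at hright
  rw [← mul_assoc] at hright
  obtain ⟨B', hB'⟩ := exists_abs_tamedKernel_le (n := n) (by omega)
  have hzero : Tendsto (fun s : ℝ => ∫ y, tamedKernel s x y * vecLaplacian h y) atTop (𝓝 0) := by
    have hpow : Tendsto (fun s : ℝ => (s ^ 2) ^ (-((n : ℝ) / 2 - 1))) atTop (𝓝 0) :=
      (tendsto_rpow_neg_atTop ha).comp (tendsto_pow_atTop two_ne_zero)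
    refine squeeze_zero_norm (a := fun s : ℝ => B' * (s ^ 2) ^ (-((n : ℝ) / 2 - 1)) *
      ∫ y, ‖vecLaplacian h y‖) (fun s => ?_) (by simpa using (hpow.const_mul B').mul_const _)
    rw [← integral_const_mul]
    refine norm_integral_le_of_norm_le (hLi.norm.const_mul _) (Eventually.of_forall fun y => ?_)
    rw [norm_mul]
    exact mul_le_mul_of_nonneg_right (hB' s x y) (norm_nonneg _)
  have hleft : Tendsto (fun s : ℝ =>
      ∫ y, (tamedKernel s⁻¹ x y - tamedKernel s x y) * vecLaplacian h y) atTop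
      (𝓝 (∫ y, (‖y - x‖ ^ 2) ^ (-((n : ℝ) / 2 - 1)) * vecLaplacian h y)) := by
    have := hzero.const_sub
      (∫ y, (‖y - x‖ ^ 2) ^ (-((n : ℝ) / 2 - 1)) * vecLaplacian h y)
    rw [sub_zero] at this
    refine this.congr' ?_
    have hev : ∀ᶠ s : ℝ in atTop, s⁻¹ < ‖x‖ - R :=
      tendsto_inv_atTop_zero.eventually (gt_mem_nhds (sub_pos.2 hx))
    filter_upwards [hev, eventually_gt_atTop 0] with s hs hs0
    have e : ∀ y, (‖y - x‖ ^ 2) ^ (-((n : ℝ) / 2 - 1)) * vecLaplacian h y =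
        tamedKernel s⁻¹ x y * vecLaplacian h y := fun y => by
      by_cases hy : R < ‖y‖
      · simp [hR y hy]
      · rw [tamedKernel_of_le (inv_pos.2 hs0)]
        have := norm_sub_norm_le x y
        rw [norm_sub_rev] at this
        linarith
    have hi : ∀ r : ℝ, Integrable fun y => tamedKernel r x y * vecLaplacian h y := fun r =>
      ((contDiff_tamedKernel r x).continuous.mul hLc).integrable_of_hasCompactSupport
        hsupp.mul_left
    simp_rw [e, sub_mul]
    rw [integral_sub (hi _) (hi _)]
  refine tendsto_nhds_unique (hright.congr' ?_) hleft
  filter_upwards [eventually_gt_atTop 0] with s hs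
  exact (integral_tamedKernel_sub_mul hh x (inv_pos.2 hs) hs).symm

end Representation

section MultipoleExpansion

variable {E : Type*} [NormedAddCommGroup E] [InnerProductSpace ℝ E]

theorem exists_abs_rpow_norm_sub_sq_sub_le {a R : ℝ} (ha : 0 ≤ a) (hR : 0 < R) :
    ∃ C > 0, ∃ R₀ > 0, ∀ x y : E, R₀ ≤ ‖x‖ → ‖y‖ ≤ R →
      |(‖y - x‖ ^ 2) ^ (-a) - (‖x‖ ^ 2) ^ (-a) * (1 + 2 * a * (inner ℝ x y / ‖x‖ ^ 2))| ≤
        C * ((‖x‖ ^ 2) ^ (-a) / ‖x‖ ^ 2) := by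
  obtain ⟨C, hC, r, hr, h⟩ := exists_abs_rpow_neg_sub_le a
  refine ⟨9 * C * R ^ 2 + a * R ^ 2, by positivity, max R (3 * R / r),
    lt_max_of_lt_left hR, fun x y hx hy => ?_⟩
  obtain ⟨hx1, hx2⟩ := max_le_iff.1 hx
  have hx0 : 0 < ‖x‖ := hR.trans_le hx1
  set d := (‖y‖ ^ 2 - 2 * inner ℝ x y) / ‖x‖ ^ 2 with hd
  have hyx : ‖y - x‖ ^ 2 = ‖x‖ ^ 2 * (1 + d) := by
    rw [norm_sub_sq_real, real_inner_comm, hd]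
    field_simp
    ring
  have hd0 : 0 ≤ 1 + d := by
    by_contra hneg
    nlinarith [sq_nonneg ‖y - x‖, pow_pos hx0 2]
  have hin := abs_le.1 (abs_real_inner_le_norm x y)
  have hxy : ‖x‖ * ‖y‖ ≤ ‖x‖ * R := by gcongr
  have hyy : ‖y‖ ^ 2 ≤ R ^ 2 := by gcongr
  have hd1 : |d| ≤ 3 * R / ‖x‖ := by
    rw [hd, abs_div, abs_of_nonneg (sq_nonneg ‖x‖), div_le_div_iff₀ (by positivity) hx0]
    have : |‖y‖ ^ 2 - 2 * inner ℝ x y| ≤ 3 * R * ‖x‖ := by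
      rw [abs_le]
      constructor <;> nlinarith [sq_nonneg ‖y‖]
    nlinarith
  have hd2 : |d| ≤ r := hd1.trans (by
    rw [div_le_iff₀ hx0]
    rw [div_le_iff₀ hr] at hx2
    linarith)
  have hdsq : d ^ 2 ≤ 9 * R ^ 2 / ‖x‖ ^ 2 := by
    rw [← sq_abs]
    calc |d| ^ 2 ≤ (3 * R / ‖x‖) ^ 2 := by gcongr
      _ = _ := by ring
  have hmain : |(1 + d) ^ (-a) - (1 + 2 * a * (inner ℝ x y / ‖x‖ ^ 2))| ≤
      (9 * C * R ^ 2 + a * R ^ 2) / ‖x‖ ^ 2 := by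
    have e : (1 + d) ^ (-a) - (1 + 2 * a * (inner ℝ x y / ‖x‖ ^ 2)) =
        ((1 + d) ^ (-a) - 1 + a * d) - a * (‖y‖ ^ 2 / ‖x‖ ^ 2) := by
      rw [hd]
      ring
    rw [e]
    refine (abs_sub _ _).trans ?_
    have h1 : C * d ^ 2 ≤ C * (9 * R ^ 2 / ‖x‖ ^ 2) := by gcongr
    have h2 : a * (‖y‖ ^ 2 / ‖x‖ ^ 2) ≤ a * (R ^ 2 / ‖x‖ ^ 2) := by gcongr
    rw [abs_of_nonneg (show 0 ≤ a * (‖y‖ ^ 2 / ‖x‖ ^ 2) by positivity)]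
    calc _ ≤ C * (9 * R ^ 2 / ‖x‖ ^ 2) + a * (R ^ 2 / ‖x‖ ^ 2) :=
          add_le_add ((h d hd2).trans h1) h2
      _ = _ := by ring
  have hp := Real.rpow_nonneg (sq_nonneg ‖x‖) (-a)
  rw [hyx, Real.mul_rpow (sq_nonneg _) hd0, ← mul_sub, abs_mul, abs_of_nonneg hp]
  calc _ ≤ (‖x‖ ^ 2) ^ (-a) * ((9 * C * R ^ 2 + a * R ^ 2) / ‖x‖ ^ 2) := by gcongr
    _ = _ := by ring

/-- The potential of a compactly supported density equals its monopole and dipole terms up to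
an error of the size of the quadrupole term. -/
theorem exists_abs_integral_rpow_mul_sub_le [FiniteDimensional ℝ E] [MeasurableSpace E]
    [BorelSpace E] (μ : Measure E) [IsFiniteMeasureOnCompacts μ] {a R : ℝ} (ha : 0 ≤ a)
    (hR : 0 < R) {φ : E → ℝ} (hφ : Continuous φ) (hsupp : ∀ y, R < ‖y‖ → φ y = 0) :
    ∃ (A : ℝ) (b : E), ∃ C > 0, ∃ R₀ > 0, ∀ x : E, R₀ ≤ ‖x‖ →
      |(∫ y, (‖y - x‖ ^ 2) ^ (-a) * φ y ∂μ) -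
        (‖x‖ ^ 2) ^ (-a) * (A + inner ℝ x b / ‖x‖ ^ 2)| ≤
        C * ((‖x‖ ^ 2) ^ (-a) / ‖x‖ ^ 2) := by
  obtain ⟨C, hC, R₀, hR₀, h⟩ := exists_abs_rpow_norm_sub_sq_sub_le (E := E) ha hR
  have hcs : HasCompactSupport φ :=
    HasCompactSupport.intro (isCompact_closedBall 0 R) fun y hy => hsupp y (by simpa using hy)
  have hi : Integrable φ μ := hφ.integrable_of_hasCompactSupport hcs
  have hiv : Integrable (fun y => φ y • y) μ :=
    (hφ.smul continuous_id).integrable_of_hasCompactSupport hcs.smul_right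
  refine ⟨∫ y, φ y ∂μ, (2 * a) • ∫ y, φ y • y ∂μ, C * ((∫ y, ‖φ y‖ ∂μ) + 1),
    mul_pos hC (add_pos_of_nonneg_of_pos (integral_nonneg fun _ => norm_nonneg _) one_pos),
    max R₀ (2 * R), lt_max_of_lt_left hR₀, fun x hx => ?_⟩
  obtain ⟨hx1, hx2⟩ := max_le_iff.1 hx
  have hi1 : Integrable (fun y => (‖x‖ ^ 2) ^ (-a) *
      (1 + 2 * a * (inner ℝ x y / ‖x‖ ^ 2)) * φ y) μ := by
    refine Continuous.integrable_of_hasCompactSupport ?_ hcs.mul_left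
    fun_prop
  have e1 : ∫ y, (‖x‖ ^ 2) ^ (-a) * (1 + 2 * a * (inner ℝ x y / ‖x‖ ^ 2)) * φ y ∂μ =
      (‖x‖ ^ 2) ^ (-a) * ((∫ y, φ y ∂μ) +
        inner ℝ x ((2 * a) • ∫ y, φ y • y ∂μ) / ‖x‖ ^ 2) := by
    rw [real_inner_smul_right, ← integral_inner hiv, mul_div_right_comm, ← integral_const_mul,
      ← integral_add hi ((hiv.const_inner x).const_mul _), ← integral_const_mul]
    refine integral_congr_ae (Eventually.of_forall fun y => ?_)
    simp only [real_inner_smul_right]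
    ring
  have hnorm : ∀ y : E, ‖y‖ ≤ R → y - x ≠ 0 := fun y hy h0 => by
    rw [sub_eq_zero] at h0
    subst h0
    linarith
  have hi0 : Integrable (fun y => (‖y - x‖ ^ 2) ^ (-a) * φ y) μ := by
    have hsub : ∀ y, y ∈ tsupport φ → ‖y‖ ≤ R := fun y hy => by
      have : tsupport φ ⊆ Metric.closedBall 0 R :=
        closure_minimal (fun z hz => by
          by_contra hz'
          exact hz (hsupp z (by simpa using hz'))) Metric.isClosed_closedBall
      simpa using this hy
    refine Continuous.integrable_of_hasCompactSupport ?_ hcs.mul_left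
    refine continuous_of_tsupport fun y hy => ?_
    have hy' : y ∈ tsupport φ := tsupport_mul_subset_right hy
    refine ContinuousAt.mul ?_ hφ.continuousAt
    refine ContinuousAt.rpow_const (by fun_prop) (Or.inl ?_)
    exact pow_ne_zero 2 (norm_ne_zero_iff.2 (hnorm y (hsub y hy')))
  rw [← e1, ← integral_sub hi0 hi1]
  have hK : 0 ≤ (‖x‖ ^ 2) ^ (-a) / ‖x‖ ^ 2 := by positivity
  calc _ ≤ ∫ y, C * ((‖x‖ ^ 2) ^ (-a) / ‖x‖ ^ 2) * ‖φ y‖ ∂μ := by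
        rw [← Real.norm_eq_abs]
        refine norm_integral_le_of_norm_le (hi.norm.const_mul _)
          (Eventually.of_forall fun y => ?_)
        rw [← sub_mul, norm_mul]
        by_cases hy : R < ‖y‖
        · simp [hsupp y hy]
        · exact mul_le_mul_of_nonneg_right (h x y hx1 (not_lt.1 hy)) (norm_nonneg _)
    _ = C * ((‖x‖ ^ 2) ^ (-a) / ‖x‖ ^ 2) * ∫ y, ‖φ y‖ ∂μ := integral_const_mul _ _
    _ ≤ _ := by nlinarith [mul_nonneg hC.le hK]

theorem eq_zero_of_tendsto_norm_mul_add [Nontrivial E] {A : ℝ} {b : E}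
    (h : Tendsto (fun x : E => ‖x‖ * (A + inner ℝ x b / ‖x‖ ^ 2)) (comap norm atTop) (𝓝 0)) :
    A = 0 ∧ b = 0 := by
  have hray : ∀ v : E, v ≠ 0 →
      Tendsto (fun t : ℝ => t * (‖v‖ * A) + inner ℝ v b / ‖v‖) atTop (𝓝 0) := fun v hv => by
    have hv' : 0 < ‖v‖ := norm_pos_iff.2 hv
    have hl : Tendsto (fun t : ℝ => t • v) atTop (comap norm atTop) := by
      rw [tendsto_comap_iff]
      refine (tendsto_id.atTop_mul_const hv').congr' ?_
      filter_upwards [eventually_ge_atTop 0] with t ht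
      simp [norm_smul, abs_of_nonneg ht]
    refine (h.comp hl).congr' ?_
    filter_upwards [eventually_gt_atTop 0] with t ht
    simp only [Function.comp_apply, norm_smul, Real.norm_eq_abs, abs_of_pos ht,
      real_inner_smul_left]
    field_simp
  have hA : A = 0 := by
    obtain ⟨v, hv⟩ := exists_ne (0 : E)
    have h1 := tendsto_inv_atTop_zero.mul ((hray v hv).add (hray (-v) (neg_ne_zero.2 hv)))
    have h2 : Tendsto (fun _ : ℝ => 2 * ‖v‖ * A) atTop (𝓝 (0 * (0 + 0))) := by
      refine h1.congr' ?_
      filter_upwards [eventually_gt_atTop 0] with t ht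
      rw [norm_neg, inner_neg_left]
      field_simp
      ring
    have h3 := tendsto_nhds_unique h2 tendsto_const_nhds
    simpa [hv] using h3.symm
  refine ⟨hA, by_contra fun hb => ?_⟩
  have h1 := hray b hb
  simp only [hA, mul_zero, zero_add] at h1
  have h2 := tendsto_nhds_unique h1 tendsto_const_nhds
  rw [real_inner_self_eq_norm_sq] at h2
  have : 0 < ‖b‖ := norm_pos_iff.2 hb
  exact absurd h2 (by positivity)

end MultipoleExpansion

theorem exists_contDiff_eq_of_contDiffOn_norm_gt {n : ℕ} {f : EuclideanSpace ℝ (Fin n) → ℝ}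
    {R : ℝ} (hR : 0 < R) {k : ℕ∞} (hf : ContDiffOn ℝ k f {x | R < ‖x‖}) :
    ∃ h : EuclideanSpace ℝ (Fin n) → ℝ, ContDiff ℝ k h ∧ ∀ x, R + 2 ≤ ‖x‖ → h x = f x := by
  let χ : ContDiffBump (0 : EuclideanSpace ℝ (Fin n)) := ⟨R + 1, R + 2, by linarith, by linarith⟩
  refine ⟨fun x => (1 - χ x) * f x, contDiff_iff_contDiffAt.2 fun x => ?_, fun x hx => ?_⟩
  · by_cases hx : R < ‖x‖
    · have ho : IsOpen {x : EuclideanSpace ℝ (Fin n) | R < ‖x‖} :=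
        isOpen_lt continuous_const continuous_norm
      exact (contDiffAt_const.sub χ.contDiffAt).mul (hf.contDiffAt (ho.mem_nhds hx))
    · refine (contDiffAt_const (c := (0 : ℝ))).congr_of_eventuallyEq ?_
      have hm : Metric.ball (0 : EuclideanSpace ℝ (Fin n)) (R + 1) ∈ 𝓝 x :=
        Metric.isOpen_ball.mem_nhds (by rw [mem_ball_zero_iff]; linarith)
      filter_upwards [hm] with y hy
      rw [χ.one_of_mem_closedBall (Metric.ball_subset_closedBall hy), sub_self, zero_mul]
  · change (1 - χ x) * f x = f x
    rw [χ.zero_of_le_dist (by simpa using hx), sub_zero, one_mul]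

/-- Let `n ≥ 3`, `R > 0`, and let `f` be a smooth harmonic function on `{x ∈ ℝⁿ : |x| > R}`
with `f(x) = o(|x|^{1−n})` as `|x| → ∞`. Then `f(x) = O(|x|^{−n})` as `|x| → ∞`. -/
theorem harmonic_littleO_one_sub_n_implies_bigO_neg_n (n : ℕ) (hn : 3 ≤ n)
    (R : ℝ) (hR : 0 < R)
    (f : EuclideanSpace ℝ (Fin n) → ℝ)
    (hf : IsHarmonicOn f {x | R < ‖x‖})
    (ho : Tendsto (fun x : EuclideanSpace ℝ (Fin n) => ‖x‖ ^ ((n : ℝ) - 1) * f x)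
      (comap norm atTop) (nhds 0)) :
    ∃ C > 0, ∃ R₀ > 0, ∀ x : EuclideanSpace ℝ (Fin n), R₀ ≤ ‖x‖ →
      |f x| ≤ C * ‖x‖ ^ (-(n : ℝ)) := by
  have hn' : (3 : ℝ) ≤ n := by exact_mod_cast hn
  have ha : (0 : ℝ) ≤ n / 2 - 1 := by linarith
  have : Nonempty (Fin n) := ⟨⟨0, by omega⟩⟩
  have hlarge : ∀ r : ℝ, ∀ᶠ x : EuclideanSpace ℝ (Fin n) in comap norm atTop, r < ‖x‖ :=
    fun r => tendsto_comap.eventually (eventually_gt_atTop r)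
  obtain ⟨h, hh, hfh⟩ := exists_contDiff_eq_of_contDiffOn_norm_gt hR hf.1
  have hh2 : ContDiff ℝ 2 h := contDiff_infty.1 hh 2
  have hh0 : Tendsto h (cocompact _) (𝓝 0) := by
    rw [← Metric.cobounded_eq_cocompact, ← comap_norm_atTop]
    refine squeeze_zero_norm' (a := fun x => ‖‖x‖ ^ ((n : ℝ) - 1) * f x‖) ?_
      (norm_zero (E := ℝ) ▸ ho.norm)
    filter_upwards [hlarge (R + 2), hlarge 1] with x hx hx1
    rw [hfh x hx.le, norm_mul]
    refine le_mul_of_one_le_left (norm_nonneg _) ?_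
    rw [Real.norm_of_nonneg (by positivity)]
    exact Real.one_le_rpow hx1.le (by linarith)
  have hΔ : ∀ y, R + 2 < ‖y‖ → vecLaplacian h y = 0 := fun y hy => by
    have hev : h =ᶠ[𝓝 y] f := by
      filter_upwards [(isOpen_lt continuous_const continuous_norm).mem_nhds hy] with z hz
      exact hfh z (le_of_lt hz)
    rw [vecLaplacian_congr hev]
    exact hf.2 y (show R < ‖y‖ by linarith)
  obtain ⟨c, hc, hrep⟩ := exists_mul_eq_integral_rpow_mul_vecLaplacian hn hh2 hh0 hΔ
  obtain ⟨A, b, C, hC, R₀, hR₀, hexp⟩ := exists_abs_integral_rpow_mul_sub_le volume ha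
    (by linarith : 0 < R + 2) hh2.continuous_vecLaplacian hΔ
  have hexp' : ∀ x, R₀ ≤ ‖x‖ → R + 2 < ‖x‖ →
      |c * f x - (‖x‖ ^ 2) ^ (-((n : ℝ) / 2 - 1)) * (A + inner ℝ x b / ‖x‖ ^ 2)| ≤
        C * ‖x‖ ^ (-(n : ℝ)) := fun x hx hx' => by
    have hx0 : 0 < ‖x‖ := hR₀.trans_le hx
    have e : ‖x‖ ^ (-(n : ℝ)) = (‖x‖ ^ 2) ^ (-((n : ℝ) / 2 - 1)) / ‖x‖ ^ 2 := by
      rw [← Real.rpow_natCast ‖x‖ 2, ← Real.rpow_mul hx0.le, ← Real.rpow_sub hx0]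
      congr 1
      push_cast
      ring
    rw [← hfh x hx'.le, hrep x hx', e]
    exact hexp x hx
  have hlim : Tendsto (fun x => ‖x‖ * (A + inner ℝ x b / ‖x‖ ^ 2)) (comap norm atTop) (𝓝 0) := by
    have h1 : Tendsto (fun x : EuclideanSpace ℝ (Fin n) => C * ‖x‖⁻¹) (comap norm atTop)
        (𝓝 0) := by
      have h := (tendsto_inv_atTop_zero (𝕜 := ℝ)).comp
        (tendsto_comap (f := fun x : EuclideanSpace ℝ (Fin n) => ‖x‖))
      simpa [Function.comp_def] using h.const_mul C
    have h2 : Tendsto (fun x => c * (‖x‖ ^ ((n : ℝ) - 1) * f x) -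
        ‖x‖ * (A + inner ℝ x b / ‖x‖ ^ 2)) (comap norm atTop) (𝓝 0) := by
      refine squeeze_zero_norm' ?_ h1
      filter_upwards [hlarge (R + 2), hlarge R₀] with x hx hx'
      have hx0 : 0 < ‖x‖ := hR₀.trans hx'
      have e1 : ‖x‖ = ‖x‖ ^ ((n : ℝ) - 1) * (‖x‖ ^ 2) ^ (-((n : ℝ) / 2 - 1)) := by
        rw [← Real.rpow_natCast ‖x‖ 2, ← Real.rpow_mul hx0.le, ← Real.rpow_add hx0]
        nth_rw 1 [← Real.rpow_one ‖x‖]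
        congr 1
        push_cast
        ring
      have e2 : ‖x‖⁻¹ = ‖x‖ ^ ((n : ℝ) - 1) * ‖x‖ ^ (-(n : ℝ)) := by
        rw [← Real.rpow_add hx0, ← Real.rpow_neg_one]
        congr 1
        ring
      have e3 : c * (‖x‖ ^ ((n : ℝ) - 1) * f x) - ‖x‖ * (A + inner ℝ x b / ‖x‖ ^ 2) =
          ‖x‖ ^ ((n : ℝ) - 1) * (c * f x -
            (‖x‖ ^ 2) ^ (-((n : ℝ) / 2 - 1)) * (A + inner ℝ x b / ‖x‖ ^ 2)) := by
        linear_combination (-(A + inner ℝ x b / ‖x‖ ^ 2)) * e1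
      rw [e3, norm_mul, Real.norm_of_nonneg (by positivity), e2, mul_left_comm]
      exact mul_le_mul_of_nonneg_left (hexp' x hx'.le hx) (by positivity)
    simpa using (ho.const_mul c).sub h2
  obtain ⟨rfl, rfl⟩ := eq_zero_of_tendsto_norm_mul_add hlim
  refine ⟨C / |c|, by positivity, max R₀ (R + 3), lt_max_of_lt_left hR₀, fun x hx => ?_⟩
  obtain ⟨hx1, hx2⟩ := max_le_iff.1 hx
  have := hexp' x hx1 (by linarith)
  simp only [inner_zero_right, zero_div, add_zero, mul_zero, sub_zero, abs_mul] at this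
  rw [div_mul_eq_mul_div, le_div_iff₀ (abs_pos.2 hc), mul_comm]
  exact this
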